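/- For integers k ≥ m ≥ 1, let B be a k×m random matrix with i.i.d. Gaussian N(0,1/k) entries, let σ_min(B) = min{‖Bx‖ : x ∈ ℝ^m, ‖x‖ = 1} be its least singular value, and set F_{k,m}(t) = P(σ_min(B) ≤ t). Suppose m_k is a sequence of positive integers with m_k/k → α for some α ∈ (0,1). Then for every t > 0: liminf_{k→∞} (1/k) log( 1 / F_{k,m_k}(t) ) ≥ ((1 − α)/2) · log( (1 − α)² / (e·t²) ) + (α/2) · log α. -/

import Mathlib

open MeasureTheory ProbabilityTheory Filter Real
open scoped NNReal ENNReal Topology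

/-- Least singular value of a `k×m` matrix: `σ_min(B) = min{‖Bx‖ : ‖x‖ = 1}`
(Euclidean norms), expressed as an infimum. -/
noncomputable def sigmaMin (k m : ℕ) (B : Fin k → Fin m → ℝ) : ℝ :=
  sInf {r : ℝ | ∃ x : Fin m → ℝ, (∑ j, (x j) ^ 2) = 1 ∧
    r = Real.sqrt (∑ i, (∑ j, B i j * x j) ^ 2)}

/-- `F_{k,m}(t) = P(σ_min(B) ≤ t)` for a `k×m` random matrix `B` with i.i.d. `N(0,1/k)`
entries. -/
noncomputable def Fkm (k m : ℕ) (t : ℝ) : ℝ :=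
  ((Measure.pi fun _ : Fin k => Measure.pi fun _ : Fin m =>
      gaussianReal 0 (1 / (k : ℝ≥0))) {B | sigmaMin k m B ≤ t}).toReal

lemma gaussianPDFReal_mul_exp_sq (a x : ℝ) :
    gaussianPDFReal 0 1 x * exp (a * x ^ 2) =
      (√(2 * π))⁻¹ * exp (-(1 / 2 - a) * x ^ 2) := by
  rw [gaussianPDFReal, mul_assoc, ← exp_add]
  simp only [NNReal.coe_one, mul_one, sub_zero]
  congr 2
  ring

lemma integrable_exp_mul_sq_gaussianReal {a : ℝ} (ha : a < 1 / 2) :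
    Integrable (fun x => exp (a * x ^ 2)) (gaussianReal 0 1) := by
  rw [gaussianReal_of_var_ne_zero _ one_ne_zero,
    integrable_withDensity_iff_integrable_smul' (measurable_gaussianPDF _ _)
      (ae_of_all _ fun _ => gaussianPDF_lt_top)]
  simp_rw [toReal_gaussianPDF, smul_eq_mul, gaussianPDFReal_mul_exp_sq]
  exact (integrable_exp_neg_mul_sq (by linarith)).const_mul _

lemma integral_exp_mul_sq_gaussianReal {a : ℝ} (ha : a < 1 / 2) :
    ∫ x, exp (a * x ^ 2) ∂(gaussianReal 0 1) = (√(1 - 2 * a))⁻¹ := by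
  rw [integral_gaussianReal_eq_integral_smul one_ne_zero]
  simp_rw [smul_eq_mul, gaussianPDFReal_mul_exp_sq]
  rw [integral_const_mul, integral_gaussian, ← sqrt_inv, ← sqrt_mul (by positivity), ← sqrt_inv]
  congr 1
  have : 1 / 2 - a ≠ 0 := by linarith
  have : 1 - 2 * a ≠ 0 := by linarith
  have := pi_pos.ne'
  field_simp

lemma exp_mul_sum_sq_eq_prod {ι : Type*} [Fintype ι] [DecidableEq ι] (s : Finset ι) (a : ℝ)
    (x : ι → ℝ) :
    exp (a * ∑ i ∈ s, x i ^ 2) = ∏ i, (if i ∈ s then exp (a * x i ^ 2) else 1) := by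
  rw [Finset.prod_ite_mem, Finset.univ_inter, ← exp_sum, Finset.mul_sum]

lemma integrable_exp_mul_sum_sq {ι : Type*} [Fintype ι] (s : Finset ι) {a : ℝ} (ha : a < 1 / 2) :
    Integrable (fun x : ι → ℝ => exp (a * ∑ i ∈ s, x i ^ 2))
      (Measure.pi fun _ => gaussianReal 0 1) := by
  classical
  simp_rw [exp_mul_sum_sq_eq_prod]
  refine Integrable.fintype_prod_dep (f := fun i y => if i ∈ s then exp (a * y ^ 2) else 1)
    fun i => ?_
  by_cases hi : i ∈ s
  · simpa [hi] using integrable_exp_mul_sq_gaussianReal ha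
  · simp [hi]

lemma integral_exp_mul_sum_sq {ι : Type*} [Fintype ι] (s : Finset ι) {a : ℝ} (ha : a < 1 / 2) :
    ∫ x : ι → ℝ, exp (a * ∑ i ∈ s, x i ^ 2) ∂(Measure.pi fun _ => gaussianReal 0 1) =
      (√(1 - 2 * a))⁻¹ ^ s.card := by
  classical
  simp_rw [exp_mul_sum_sq_eq_prod]
  rw [integral_fintype_prod_eq_prod (f := fun i y => if i ∈ s then exp (a * y ^ 2) else 1)]
  have (i : ι) : ∫ y, (if i ∈ s then exp (a * y ^ 2) else 1) ∂(gaussianReal 0 1) =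
      if i ∈ s then (√(1 - 2 * a))⁻¹ else 1 := by
    by_cases hi : i ∈ s
    · simp [hi, ← integral_exp_mul_sq_gaussianReal ha]
    · simp [hi]
  simp_rw [this]
  rw [Finset.prod_ite_mem, Finset.univ_inter, Finset.prod_const]

/-- Chernoff bound for the lower tail of a chi-square variable with `2 * p` degrees of freedom. -/
lemma measureReal_sum_sq_le {ι : Type*} [Fintype ι] (s : Finset ι) {p : ℕ} (hp : 0 < p)
    (hs : s.card = 2 * p) {ρ : ℝ} (hρ : 0 < ρ) :
    (Measure.pi fun _ : ι => gaussianReal 0 1).real {x | ∑ i ∈ s, x i ^ 2 ≤ ρ} ≤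
      (exp 1 * ρ / (2 * p)) ^ p := by
  have hp' : (0 : ℝ) < p := by exact_mod_cast hp
  have ht : -(p / ρ) ≤ 0 := by rw [neg_nonpos]; positivity
  refine (measure_le_le_exp_mul_mgf ρ ht (integrable_exp_mul_sum_sq s (by linarith))).trans ?_
  rw [mgf, integral_exp_mul_sum_sq s (by linarith), hs, pow_mul, inv_pow,
    sq_sqrt (by linarith), neg_neg, div_mul_cancel₀ _ hρ.ne', ← mul_one (p : ℝ), exp_nat_mul,
    ← mul_pow, mul_one, mul_div_assoc]
  have h : (1 - 2 * -(p / ρ))⁻¹ ≤ ρ / (2 * p) := by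
    rw [inv_le_comm₀ (by linarith) (by positivity), inv_div]
    have : 2 * (p : ℝ) / ρ = 2 * (p / ρ) := by ring
    linarith
  have h0 : 0 ≤ (1 - 2 * -(p / ρ))⁻¹ := inv_nonneg.2 (by linarith)
  gcongr

lemma stdGaussian_exists_norm_add_sq_lt_le {E : Type*} [NormedAddCommGroup E]
    [InnerProductSpace ℝ E] [FiniteDimensional ℝ E] [MeasurableSpace E] [BorelSpace E]
    (H : Submodule ℝ E) {p : ℕ} (hp : 0 < p)
    (hH : Module.finrank ℝ H + 2 * p ≤ Module.finrank ℝ E) {ρ : ℝ} (hρ : 0 < ρ) :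
    stdGaussian E {h | ∃ w ∈ H, ‖h + w‖ ^ 2 < ρ} ≤
      ENNReal.ofReal ((exp 1 * ρ / (2 * p)) ^ p) := by
  classical
  have hK : 2 * p ≤ Module.finrank ℝ Hᗮ := by
    have := H.finrank_add_finrank_orthogonal
    omega
  let c := stdOrthonormalBasis ℝ Hᗮ
  let v : Fin (Module.finrank ℝ E) → E := fun i =>
    if h : (i : ℕ) < 2 * p then (c ⟨i, h.trans_le hK⟩ : E) else 0
  let s : Set (Fin (Module.finrank ℝ E)) := {i | (i : ℕ) < 2 * p}
  have hv : Orthonormal ℝ (s.domRestrict v) := by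
    have h1 : Orthonormal ℝ (fun i : Fin (Module.finrank ℝ Hᗮ) => (c i : E)) :=
      c.orthonormal.comp_linearIsometry Hᗮ.subtypeₗᵢ
    have h2 := h1.comp (fun i : s => (⟨i.1, lt_of_lt_of_le i.2 hK⟩ : Fin _))
      (fun i j hij => by
        simp only [Fin.mk.injEq] at hij
        exact Subtype.ext (Fin.ext hij))
    convert h2 using 1
    ext i
    have : (i.1 : ℕ) < 2 * p := i.2
    simp [v, this]
  obtain ⟨b, hb⟩ := hv.exists_orthonormalBasis_extension_of_card_eq (by simp)
  let t : Finset (Fin (Module.finrank ℝ E)) := {i | (i : ℕ) < 2 * p}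
  have ht : t.card = 2 * p := by
    have : t = Finset.univ.map (Fin.castLEEmb (show 2 * p ≤ Module.finrank ℝ E by omega)) := by
      ext i
      simp only [t, Finset.mem_filter, Finset.mem_univ, true_and, Finset.mem_map]
      exact ⟨fun h => ⟨⟨i, h⟩, rfl⟩, by rintro ⟨j, rfl⟩; exact j.2⟩
    simp [this]
  have hopen : IsOpen {h : E | ∃ w ∈ H, ‖h + w‖ ^ 2 < ρ} := by
    have : {h : E | ∃ w ∈ H, ‖h + w‖ ^ 2 < ρ} = ⋃ w ∈ H, {h | ‖h + w‖ ^ 2 < ρ} := by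
      ext; simp
    rw [this]
    exact isOpen_biUnion fun w _ => isOpen_lt (by fun_prop) (by fun_prop)
  rw [stdGaussian_eq_map_pi_orthonormalBasis b,
    Measure.map_apply (by fun_prop) hopen.measurableSet]
  refine le_trans (measure_mono (t := {x | ∑ i ∈ t, x i ^ 2 ≤ ρ}) ?_) ?_
  · rintro x ⟨w, hw, hlt⟩
    refine le_trans ?_ hlt.le
    rw [← b.sum_sq_inner_right]
    refine le_trans (le_of_eq ?_)
      (Finset.sum_le_sum_of_subset_of_nonneg t.subset_univ fun _ _ _ => sq_nonneg _)
    refine Finset.sum_congr rfl fun i hi => ?_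
    have hi' : (i : ℕ) < 2 * p := by simpa [t] using hi
    have hbi : b i ∈ Hᗮ := by
      rw [hb i hi']
      simp [v, hi']
    rw [inner_add_right, Submodule.inner_left_of_mem_orthogonal hw hbi, add_zero,
      b.orthonormal.inner_right_fintype]
  · rw [← ofReal_measureReal]
    exact ENNReal.ofReal_le_ofReal (measureReal_sum_sq_le t hp ht hρ)

lemma measurePreserving_fin_cons (γ : Measure ℝ) [IsProbabilityMeasure γ] (k m : ℕ) :
    MeasurePreserving
      (fun X : Fin k → Fin (m + 1) → ℝ => ((fun i => X i 0), fun i (j : Fin m) => X i j.succ))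
      (Measure.pi fun _ => Measure.pi fun _ => γ)
      ((Measure.pi fun _ => γ).prod (Measure.pi fun _ => Measure.pi fun _ => γ)) :=
  (measurePreserving_arrowProdEquivProdArrow ℝ (Fin m → ℝ) (Fin k) (fun _ => γ)
    fun _ => Measure.pi fun _ => γ).comp
    (measurePreserving_pi (fun _ => Measure.pi fun _ => γ)
      (fun _ => γ.prod (Measure.pi fun _ => γ))
      fun _ => measurePreserving_piFinSuccAbove (fun _ : Fin (m + 1) => γ) 0)

lemma pi_exists_sum_add_sq_lt_le {k m p : ℕ} (hp : 0 < p) (hk : m + 2 * p ≤ k) {ρ : ℝ}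
    (hρ : 0 < ρ) :
    (Measure.pi fun _ : Fin k => Measure.pi fun _ : Fin (m + 1) => gaussianReal 0 1)
      {X | ∃ z : Fin m → ℝ, ∑ i, (X i 0 + ∑ j, X i j.succ * z j) ^ 2 < ρ} ≤
      ENNReal.ofReal ((exp 1 * ρ / (2 * p)) ^ p) := by
  let T : Set ((Fin k → ℝ) × (Fin k → Fin m → ℝ)) :=
    {q | ∃ z : Fin m → ℝ, ∑ i, (q.1 i + ∑ j, q.2 i j * z j) ^ 2 < ρ}
  have hT : IsOpen T := by
    have : T = ⋃ z : Fin m → ℝ, {q | ∑ i, (q.1 i + ∑ j, q.2 i j * z j) ^ 2 < ρ} := by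
      ext; simp [T]
    rw [this]
    exact isOpen_iUnion fun z => isOpen_lt (by fun_prop) (by fun_prop)
  have h1 := (measurePreserving_fin_cons (gaussianReal 0 1) k m).measure_preimage
    hT.measurableSet.nullMeasurableSet
  change (Measure.pi fun _ : Fin k => Measure.pi fun _ : Fin (m + 1) => gaussianReal 0 1)
    {X | ∃ z : Fin m → ℝ, ∑ i, (X i 0 + ∑ j, X i j.succ * z j) ^ 2 < ρ} = _ at h1
  rw [h1, Measure.prod_apply_symm hT.measurableSet]
  refine (lintegral_mono (g := fun _ => ENNReal.ofReal ((exp 1 * ρ / (2 * p)) ^ p))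
    fun Y => ?_).trans (by simp)
  let L : (Fin m → ℝ) →ₗ[ℝ] EuclideanSpace ℝ (Fin k) :=
    (WithLp.linearEquiv 2 ℝ (Fin k → ℝ)).symm.toLinearMap ∘ₗ Matrix.mulVecLin (Matrix.of Y)
  have hL : Module.finrank ℝ (LinearMap.range L) + 2 * p ≤
      Module.finrank ℝ (EuclideanSpace ℝ (Fin k)) := by
    have := LinearMap.finrank_range_le L
    simp only [Module.finrank_fintype_fun_eq_card, Fintype.card_fin,
      finrank_euclideanSpace] at this ⊢
    omega
  refine le_trans ?_ (stdGaussian_exists_norm_add_sq_lt_le (LinearMap.range L) hp hL hρ)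
  rw [← map_pi_eq_stdGaussian]
  refine le_trans (measure_mono ?_) (Measure.le_map_apply (by fun_prop) _)
  rintro c ⟨z, hz⟩
  refine ⟨L z, ⟨z, rfl⟩, ?_⟩
  rw [EuclideanSpace.real_norm_sq_eq]
  simpa [L, Matrix.mulVec, dotProduct] using hz

open scoped RealInnerProductSpace in
lemma pi_stdGaussian_exists_sum_inner_sq_lt_le {k m p : ℕ} (hp : 0 < p) (hk : m + 2 * p ≤ k)
    {r : ℝ} (hr : 0 < r) (u : EuclideanSpace ℝ (Fin (m + 1))) :
    (Measure.pi fun _ : Fin k => stdGaussian (EuclideanSpace ℝ (Fin (m + 1))))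
      {G | ∃ y, ∑ i, ⟪G i, y⟫ ^ 2 < r ^ 2 * ⟪u, y⟫ ^ 2} ≤
      ENNReal.ofReal ((exp 1 * (r ^ 2 * ‖u‖ ^ 2) / (2 * p)) ^ p) := by
  rcases eq_or_ne u 0 with rfl | hu
  · simp [Finset.sum_nonneg, sq_nonneg, not_lt.2]
  have hu' : 0 < ‖u‖ := norm_pos_iff.2 hu
  obtain ⟨b, hb⟩ := Orthonormal.exists_orthonormalBasis_extension_of_card_eq (𝕜 := ℝ)
    (E := EuclideanSpace ℝ (Fin (m + 1))) (ι := Fin (m + 1)) (by simp)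
    (v := fun _ => ‖u‖⁻¹ • u) (s := {0}) (by
      refine ⟨fun i => ?_, fun i j hij => (hij (Subsingleton.elim _ _)).elim⟩
      simp [norm_smul, hu'.ne'])
  have hb0 : b 0 = ‖u‖⁻¹ • u := hb 0 rfl
  have hub : u = ‖u‖ • b 0 := by rw [hb0, smul_inv_smul₀ hu'.ne']
  have hopen : IsOpen {G : Fin k → EuclideanSpace ℝ (Fin (m + 1)) |
      ∃ y, ∑ i, ⟪G i, y⟫ ^ 2 < r ^ 2 * ⟪u, y⟫ ^ 2} := by
    simp only [Set.ofPred_exists]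
    exact isOpen_iUnion fun z => isOpen_lt (by fun_prop) (by fun_prop)
  refine le_trans ?_ (pi_exists_sum_add_sq_lt_le hp hk (ρ := r ^ 2 * ‖u‖ ^ 2) (by positivity))
  rw [stdGaussian_eq_map_pi_orthonormalBasis b,
    ← Measure.pi_map_pi (fun _ => Measurable.aemeasurable (by fun_prop)),
    Measure.map_apply (by fun_prop) hopen.measurableSet]
  refine measure_mono ?_
  rintro X ⟨y, hy⟩
  have hy0 : ⟪b 0, y⟫ ≠ 0 := by
    intro h0
    rw [hub, inner_smul_left, h0] at hy
    simp [Finset.sum_nonneg, sq_nonneg, not_lt.2] at hy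
  refine ⟨fun j => ⟪b j.succ, y⟫ / ⟪b 0, y⟫, ?_⟩
  have key (i : Fin k) : X i 0 + ∑ j : Fin m, X i j.succ * (⟪b j.succ, y⟫ / ⟪b 0, y⟫) =
      ⟪∑ j, X i j • b j, y⟫ / ⟪b 0, y⟫ := by
    rw [sum_inner, Fin.sum_univ_succ, add_div, Finset.sum_div]
    simp only [real_inner_smul_left, mul_div_assoc]
    rw [div_self hy0, mul_one]
  simp_rw [key, div_pow]
  rw [← Finset.sum_div, div_lt_iff₀ (by positivity)]
  refine hy.trans_eq ?_
  nth_rw 1 [hub]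
  rw [real_inner_smul_left]
  ring

lemma lintegral_exp_mul_norm_sq_stdGaussian (n : ℕ) {a : ℝ} (ha : a < 1 / 2) :
    ∫⁻ u, ENNReal.ofReal (exp (a * ‖u‖ ^ 2)) ∂(stdGaussian (EuclideanSpace ℝ (Fin n))) =
      ENNReal.ofReal ((√(1 - 2 * a))⁻¹ ^ n) := by
  rw [← map_pi_eq_stdGaussian, lintegral_map (by fun_prop) (by fun_prop)]
  simp_rw [EuclideanSpace.real_norm_sq_eq]
  rw [← ofReal_integral_eq_lintegral_ofReal (integrable_exp_mul_sum_sq Finset.univ ha)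
    (ae_of_all _ fun _ => (exp_pos _).le), integral_exp_mul_sum_sq Finset.univ ha]
  simp

lemma pow_le_mul_exp {p : ℕ} (hp : 0 < p) {a x : ℝ} (ha : 0 < a) (hx : 0 ≤ x) (r : ℝ) :
    (exp 1 * (r ^ 2 * x) / (2 * p)) ^ p ≤ (r ^ 2 / (2 * a)) ^ p * exp (a * x) := by
  have hp' : (0 : ℝ) < p := by exact_mod_cast hp
  have h1 : a * x / p ≤ exp (a * x / p - 1) := by
    have := add_one_le_exp (a * x / p - 1)
    linarith
  have h2 : exp (a * x) = exp (a * x / p) ^ p := by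
    rw [← exp_nat_mul, mul_div_cancel₀ _ hp'.ne']
  rw [h2, ← mul_pow]
  refine pow_le_pow_left₀ (by positivity) ?_ p
  have h3 : exp (a * x / p) = exp 1 * exp (a * x / p - 1) := by
    rw [← exp_add]; congr 1; ring
  rw [h3]
  calc exp 1 * (r ^ 2 * x) / (2 * p) = r ^ 2 / (2 * a) * (exp 1 * (a * x / p)) := by
        field_simp
    _ ≤ _ := by gcongr

lemma stdGaussian_inner_unit {n : ℕ} {y : EuclideanSpace ℝ (Fin n)} (hy : ‖y‖ = 1) :
    (stdGaussian (EuclideanSpace ℝ (Fin n))).map (fun u => inner ℝ y u) = gaussianReal 0 1 := by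
  have h := IsGaussian.map_eq_gaussianReal (μ := stdGaussian (EuclideanSpace ℝ (Fin n)))
    (innerSL ℝ y)
  rw [integral_strongDual_stdGaussian, variance_dual_stdGaussian, innerSL_apply_norm, hy] at h
  simpa using h

open scoped RealInnerProductSpace in
/-- Testing the least singular vector against an independent standard Gaussian vector. -/
lemma pi_stdGaussian_exists_lt_mul_le {k m p : ℕ} (hp : 0 < p) (hk : m + 2 * p ≤ k)
    {r s a : ℝ} (hr : 0 < r) (hs : 0 < s) (ha : 0 < a) (ha' : a < 1 / 2) :
    (Measure.pi fun _ : Fin k => stdGaussian (EuclideanSpace ℝ (Fin (m + 1))))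
        {G | ∃ y, ∑ i, ⟪G i, y⟫ ^ 2 < s ^ 2 * ‖y‖ ^ 2} * gaussianReal 0 1 {x | s / r ≤ |x|} ≤
      ENNReal.ofReal ((r ^ 2 / (2 * a)) ^ p * (√(1 - 2 * a))⁻¹ ^ (m + 1)) := by
  set V := EuclideanSpace ℝ (Fin (m + 1))
  set ν := Measure.pi fun _ : Fin k => stdGaussian V
  let S : Set (Fin k → V) := {G | ∃ y, ∑ i, ⟪G i, y⟫ ^ 2 < s ^ 2 * ‖y‖ ^ 2}
  let O : Set (V × (Fin k → V)) := {q | ∃ y, ∑ i, ⟪q.2 i, y⟫ ^ 2 < r ^ 2 * ⟪q.1, y⟫ ^ 2}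
  have hS : MeasurableSet S := by
    refine IsOpen.measurableSet ?_
    simp only [S, Set.ofPred_exists]
    exact isOpen_iUnion fun z => isOpen_lt (by fun_prop) (by fun_prop)
  have hO : MeasurableSet O := by
    refine IsOpen.measurableSet ?_
    simp only [O, Set.ofPred_exists]
    exact isOpen_iUnion fun z => isOpen_lt (by fun_prop) (by fun_prop)
  have hc : MeasurableSet {x : ℝ | s / r ≤ |x|} := measurableSet_le (by fun_prop) (by fun_prop)
  have lower : ν S * gaussianReal 0 1 {x | s / r ≤ |x|} ≤ ((stdGaussian V).prod ν) O := by
    rw [Measure.prod_apply_symm hO, mul_comm, ← lintegral_indicator_const hS]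
    refine lintegral_mono fun G => ?_
    by_cases hG : G ∈ S
    swap
    · simp [hG]
    rw [Set.indicator_of_mem hG]
    obtain ⟨y, hy⟩ := hG
    have hy0 : 0 < ‖y‖ := by
      rcases eq_or_ne y 0 with rfl | h
      · simp at hy
      · exact norm_pos_iff.2 h
    have hy1 : ‖‖y‖⁻¹ • y‖ = 1 := by
      rw [norm_smul, norm_inv, norm_norm, inv_mul_cancel₀ hy0.ne']
    rw [← stdGaussian_inner_unit hy1, Measure.map_apply (by fun_prop) hc]
    refine measure_mono fun u hu => ⟨y, hy.trans_le ?_⟩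
    have hu' : s / r ≤ |⟪‖y‖⁻¹ • y, u⟫| := hu
    rw [real_inner_smul_left, abs_mul, abs_of_pos (inv_pos.2 hy0), inv_mul_eq_div,
      div_le_div_iff₀ hr hy0, real_inner_comm] at hu'
    rw [← mul_pow, ← sq_abs ⟪u, y⟫, ← mul_pow, mul_comm r]
    gcongr
  refine lower.trans ?_
  rw [Measure.prod_apply hO]
  calc ∫⁻ u, ν (Prod.mk u ⁻¹' O) ∂(stdGaussian V)
      ≤ ∫⁻ u, ENNReal.ofReal ((r ^ 2 / (2 * a)) ^ p) * ENNReal.ofReal (exp (a * ‖u‖ ^ 2))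
          ∂(stdGaussian V) := by
        refine lintegral_mono fun u => ?_
        refine (pi_stdGaussian_exists_sum_inner_sq_lt_le hp hk hr u).trans ?_
        rw [← ENNReal.ofReal_mul (by positivity)]
        exact ENNReal.ofReal_le_ofReal (pow_le_mul_exp hp ha (sq_nonneg _) r)
    _ = _ := by
        rw [lintegral_const_mul _ (by fun_prop), lintegral_exp_mul_norm_sq_stdGaussian _ ha',
          ← ENNReal.ofReal_mul (by positivity)]

lemma le_gaussianReal_le_abs {a : ℝ} (ha : 0 ≤ a) :
    ENNReal.ofReal ((√(2 * π))⁻¹ * exp (-(a + 1) ^ 2 / 2)) ≤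
      gaussianReal 0 1 {x | a ≤ |x|} := by
  refine le_trans ?_ (measure_mono (s := Set.Icc a (a + 1)) fun x hx => hx.1.trans (le_abs_self x))
  rw [gaussianReal_apply _ one_ne_zero]
  calc ENNReal.ofReal ((√(2 * π))⁻¹ * exp (-(a + 1) ^ 2 / 2))
      = ∫⁻ _ in Set.Icc a (a + 1), ENNReal.ofReal ((√(2 * π))⁻¹ * exp (-(a + 1) ^ 2 / 2)) := by
        simp
    _ ≤ _ := by
        refine setLIntegral_mono (measurable_gaussianPDF 0 1) fun x hx => ?_
        rw [gaussianPDF, gaussianPDFReal]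
        have hx0 : 0 ≤ x := ha.trans hx.1
        have := hx.2
        simp only [NNReal.coe_one, mul_one, sub_zero]
        gcongr

lemma pi_gaussianReal_eq_map (k m : ℕ) :
    (Measure.pi fun _ : Fin k => Measure.pi fun _ : Fin m => gaussianReal 0 (1 / (k : ℝ≥0))) =
      (Measure.pi fun _ : Fin k => Measure.pi fun _ : Fin m => gaussianReal 0 1).map
        (fun X i j => (√k)⁻¹ * X i j) := by
  have h : gaussianReal 0 (1 / (k : ℝ≥0)) = (gaussianReal 0 1).map ((√k)⁻¹ * ·) := by
    rw [gaussianReal_map_const_mul]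
    congr 1
    · simp
    · ext; simp
  have h2 : (Measure.pi fun _ : Fin m => gaussianReal 0 (1 / (k : ℝ≥0))) =
      (Measure.pi fun _ : Fin m => gaussianReal 0 1).map (fun x j => (√k)⁻¹ * x j) := by
    rw [h, Measure.pi_map_pi (fun _ => by fun_prop)]
  rw [h2, ← Measure.pi_map_pi (fun _ => Measurable.aemeasurable (by fun_prop))]

lemma Fkm_mul_le_of_lt {k m p : ℕ} (hp : 0 < p) (hk : m + 2 * p ≤ k) {r t t' a : ℝ} (ht : 0 < t)
    (htt' : t < t') (hr : 0 < r) (ha : 0 < a) (ha' : a < 1 / 2) :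
    Fkm k (m + 1) t * ((√(2 * π))⁻¹ * exp (-(√k * t' / r + 1) ^ 2 / 2)) ≤
      (r ^ 2 / (2 * a)) ^ p * (√(1 - 2 * a))⁻¹ ^ (m + 1) := by
  have hk0 : 0 < k := by omega
  have hk0' : (0 : ℝ) < k := by exact_mod_cast hk0
  have ht' : 0 < t' := ht.trans htt'
  set A : Set (Fin k → Fin (m + 1) → ℝ) :=
    {B | ∃ x : Fin (m + 1) → ℝ, ∑ i, (∑ j, B i j * x j) ^ 2 < t' ^ 2 * ∑ j, x j ^ 2}
  have hA : MeasurableSet A := by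
    refine IsOpen.measurableSet ?_
    simp only [A, Set.ofPred_exists]
    exact isOpen_iUnion fun z => isOpen_lt (by fun_prop) (by fun_prop)
  have hsub : {B | sigmaMin k (m + 1) B ≤ t} ⊆ A := by
    intro B hB
    have hne : {r : ℝ | ∃ x : Fin (m + 1) → ℝ, (∑ j, (x j) ^ 2) = 1 ∧
        r = √(∑ i, (∑ j, B i j * x j) ^ 2)}.Nonempty :=
      ⟨_, Pi.single 0 1, by simp [Pi.single_apply], rfl⟩
    obtain ⟨_, ⟨x, hx, rfl⟩, hlt⟩ := exists_lt_of_csInf_lt hne (lt_of_le_of_lt hB htt')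
    refine ⟨x, ?_⟩
    rw [hx, mul_one]
    exact (sqrt_lt' ht').1 hlt
  have hmap : (Measure.pi fun _ : Fin k => stdGaussian (EuclideanSpace ℝ (Fin (m + 1)))) =
      (Measure.pi fun _ : Fin k => Measure.pi fun _ : Fin (m + 1) => gaussianReal 0 1).map
        (fun X i => WithLp.toLp 2 (X i)) := by
    rw [← map_pi_eq_stdGaussian, Measure.pi_map_pi (fun _ => Measurable.aemeasurable (by fun_prop))]
  have hle : (Measure.pi fun _ : Fin k => Measure.pi fun _ : Fin (m + 1) =>
      gaussianReal 0 (1 / (k : ℝ≥0))) {B | sigmaMin k (m + 1) B ≤ t} ≤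
      (Measure.pi fun _ : Fin k => stdGaussian (EuclideanSpace ℝ (Fin (m + 1))))
        {G | ∃ y, ∑ i, (inner ℝ (G i) y) ^ 2 < (√k * t') ^ 2 * ‖y‖ ^ 2} := by
    refine (measure_mono hsub).trans ?_
    rw [pi_gaussianReal_eq_map, hmap, Measure.map_apply (by fun_prop) hA]
    refine le_trans (measure_mono ?_)
      (Measure.le_map_apply (Measurable.aemeasurable (by fun_prop)) _)
    rintro X ⟨x, hx⟩
    refine ⟨WithLp.toLp 2 x, ?_⟩
    simp_rw [mul_assoc, ← Finset.mul_sum, mul_pow] at hx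
    rw [← Finset.mul_sum, inv_pow, sq_sqrt hk0'.le, inv_mul_lt_iff₀ hk0', ← mul_assoc] at hx
    rw [EuclideanSpace.real_norm_sq_eq, mul_pow, sq_sqrt hk0'.le]
    simpa [PiLp.inner_apply, mul_comm] using hx
  have main := pi_stdGaussian_exists_lt_mul_le hp hk hr (s := √k * t') (by positivity) ha ha'
  have tail := le_gaussianReal_le_abs (a := √k * t' / r) (by positivity)
  have := (mul_le_mul' hle tail).trans main
  rw [Fkm, ← ENNReal.ofReal_le_ofReal_iff (by positivity),
    ENNReal.ofReal_mul ENNReal.toReal_nonneg, ENNReal.ofReal_toReal (measure_ne_top _ _)]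
  exact this

/-- Non-asymptotic tail bound for the least singular value. -/
lemma Fkm_mul_le {k m p : ℕ} (hm : 0 < m) (hp : 0 < p) (hk : m + 2 * p ≤ k + 1) {t : ℝ}
    (ht : 0 < t) :
    Fkm k m t * ((√(2 * π))⁻¹ * exp (-(√(2 * p) + 1) ^ 2 / 2)) ≤
      (k * t ^ 2 * (m + 2 * p) / (4 * p ^ 2)) ^ p * √((m + 2 * p) / m) ^ m := by
  obtain ⟨m, rfl⟩ : ∃ n, m = n + 1 := ⟨m - 1, by omega⟩
  have hp' : (0 : ℝ) < p := by exact_mod_cast hp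
  have hk0 : (0 : ℝ) < k := by
    have : 0 < k := by omega
    exact_mod_cast this
  set M : ℝ := ((m + 1 : ℕ) : ℝ)
  have hM : 0 < M := by positivity
  have key (t' : ℝ) (htt' : t < t') :
      Fkm k (m + 1) t * ((√(2 * π))⁻¹ * exp (-(√(2 * p) + 1) ^ 2 / 2)) ≤
        (k * t' ^ 2 * (M + 2 * p) / (4 * p ^ 2)) ^ p * √((M + 2 * p) / M) ^ (m + 1) := by
    have ht' : 0 < t' := ht.trans htt'
    have h := Fkm_mul_le_of_lt (k := k) (m := m) (r := √k * t' / √(2 * p)) (a := p / (M + 2 * p))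
      hp (by omega) ht htt' (by positivity) (by positivity)
      (by rw [div_lt_div_iff₀ (by positivity) (by positivity)]; linarith)
    rw [div_div_cancel₀ (by positivity)] at h
    refine h.trans_eq ?_
    congr 2
    · rw [div_pow, mul_pow, sq_sqrt hk0.le, sq_sqrt (by positivity)]
      field_simp
      ring
    · rw [← sqrt_inv]
      congr 1
      have : 1 - 2 * (p / (M + 2 * p)) = M / (M + 2 * p) := by
        field_simp
        ring
      rw [this, inv_div]
  have hcont : Tendsto (fun t' : ℝ =>
      (k * t' ^ 2 * (M + 2 * p) / (4 * p ^ 2)) ^ p * √((M + 2 * p) / M) ^ (m + 1)) (𝓝[>] t)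
      (𝓝 ((k * t ^ 2 * (M + 2 * p) / (4 * p ^ 2)) ^ p * √((M + 2 * p) / M) ^ (m + 1))) := by
    refine Tendsto.mono_left (Continuous.tendsto ?_ t) nhdsWithin_le_nhds
    fun_prop
  exact ge_of_tendsto hcont (eventually_nhdsWithin_of_forall key)

lemma gaussianReal_abs_le_pos {t : ℝ} (ht : 0 < t) :
    0 < (gaussianReal 0 1).real {x | |x| ≤ t} := by
  refine ENNReal.toReal_pos (fun h => ?_) (measure_ne_top _ _)
  have := gaussianReal_absolutelyContinuous' 0 one_ne_zero h
  have h2 : {x : ℝ | |x| ≤ t} = Set.Icc (-t) t := by ext; simp [abs_le]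
  rw [h2, volume_Icc, ENNReal.ofReal_eq_zero] at this
  linarith

lemma pow_le_Fkm {k m : ℕ} (hk : 0 < k) (hm : 0 < m) {t : ℝ} (ht : 0 < t) :
    (gaussianReal 0 1).real {x | |x| ≤ t} ^ k ≤ Fkm k m t := by
  obtain ⟨m, rfl⟩ : ∃ n, m = n + 1 := ⟨m - 1, by omega⟩
  have hk' : (0 : ℝ) < k := by exact_mod_cast hk
  have hms : MeasurableSet {x : ℝ | |x| ≤ t} := measurableSet_le (by fun_prop) (by fun_prop)
  have hmp : (Measure.pi fun _ : Fin (m + 1) => gaussianReal 0 1)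
      {x | |x 0| ≤ t} = gaussianReal 0 1 {x | |x| ≤ t} :=
    (measurePreserving_eval (fun _ : Fin (m + 1) => gaussianReal 0 1) 0).measure_preimage
      hms.nullMeasurableSet
  have hpi : (Measure.pi fun _ : Fin k => Measure.pi fun _ : Fin (m + 1) => gaussianReal 0 1)
      (Set.univ.pi fun _ => {x | |x 0| ≤ t}) = gaussianReal 0 1 {x | |x| ≤ t} ^ k := by
    rw [Measure.pi_pi]
    simp only [Finset.prod_const, Finset.card_univ, Fintype.card_fin, hmp]
  rw [Fkm, measureReal_def, ← ENNReal.toReal_pow, ← hpi, pi_gaussianReal_eq_map]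
  refine ENNReal.toReal_mono (measure_ne_top _ _)
    (le_trans (measure_mono ?_)
      (Measure.le_map_apply (Measurable.aemeasurable (by fun_prop)) _))
  intro X hX
  have hX' (i : Fin k) : |X i 0| ≤ t := hX i trivial
  have hbdd : BddBelow {r : ℝ | ∃ x : Fin (m + 1) → ℝ, (∑ j, (x j) ^ 2) = 1 ∧
      r = √(∑ i, (∑ j, (√k)⁻¹ * X i j * x j) ^ 2)} := by
    refine ⟨0, ?_⟩
    rintro _ ⟨x, -, rfl⟩
    exact sqrt_nonneg _
  refine (csInf_le hbdd ⟨Pi.single 0 1, by simp [Pi.single_apply], rfl⟩).trans ?_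
  · refine sqrt_le_iff.2 ⟨ht.le, ?_⟩
    simp only [Pi.single_apply, mul_ite, mul_one, mul_zero, Finset.sum_ite_eq', Finset.mem_univ,
      if_true, mul_pow, inv_pow, sq_sqrt hk'.le]
    rw [← Finset.mul_sum, inv_mul_le_iff₀ hk']
    calc ∑ i, X i 0 ^ 2 ≤ ∑ _i : Fin k, t ^ 2 :=
          Finset.sum_le_sum fun i _ => sq_le_sq' (abs_le.1 (hX' i)).1 (abs_le.1 (hX' i)).2
      _ = k * t ^ 2 := by simp

lemma sub_le_log_one_div_Fkm {k m p : ℕ} (hm : 0 < m) (hp : 0 < p) (hk : m + 2 * p ≤ k + 1)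
    {t : ℝ} (ht : 0 < t) {a b c : ℝ} (ha : a = m / k) (hb : b = (2 * p : ℕ) / k)
    (hc : c = 1 / (k : ℝ)) :
    c * log (√(2 * π))⁻¹ - (√b + √c) ^ 2 / 2 - b / 2 * log (t ^ 2 * (a + b) / b ^ 2) -
      a / 2 * log ((a + b) / a) ≤ 1 / (k : ℝ) * log (1 / Fkm k m t) := by
  have hp' : (0 : ℝ) < p := by exact_mod_cast hp
  have hm' : (0 : ℝ) < m := by exact_mod_cast hm
  have hk0 : 0 < k := by omega
  have hk' : (0 : ℝ) < k := by exact_mod_cast hk0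
  have hF : 0 < Fkm k m t := (pow_pos (gaussianReal_abs_le_pos ht) k).trans_le
    (pow_le_Fkm hk0 hm ht)
  have h := log_le_log (by positivity) (Fkm_mul_le hm hp hk ht)
  rw [log_mul hF.ne' (by positivity), log_mul (by positivity) (by positivity), log_exp,
    log_mul (by positivity) (by positivity), log_pow, log_pow, log_sqrt (by positivity)] at h
  have e1 : t ^ 2 * (a + b) / b ^ 2 = k * t ^ 2 * (m + 2 * p) / (4 * p ^ 2) := by
    rw [ha, hb]; push_cast; field_simp; ring
  have e2 : (a + b) / a = (m + 2 * p) / m := by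
    rw [ha, hb]; push_cast; field_simp
  have e3 : (√b + √c) ^ 2 = (√(2 * p) + 1) ^ 2 / k := by
    rw [hb, hc, sqrt_div' _ hk'.le, sqrt_div' _ hk'.le, ← add_div, div_pow, sq_sqrt hk'.le]
    simp
  rw [e1, e2, e3, ha, hb, hc, one_div (Fkm k m t), log_inv (Fkm k m t)]
  set A := log (√(2 * π))⁻¹
  set X := log (k * t ^ 2 * (m + 2 * p) / (4 * p ^ 2))
  set Y := log ((m + 2 * p) / m)
  push_cast
  calc 1 / (k : ℝ) * A - (√(2 * p) + 1) ^ 2 / k / 2 - 2 * p / k / 2 * X - m / k / 2 * Y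
      = 1 / k * (A + -(√(2 * p) + 1) ^ 2 / 2 - (p * X + m * (Y / 2))) := by field_simp; ring
    _ ≤ 1 / k * -log (Fkm k m t) := by
        gcongr
        linarith

lemma tendsto_two_mul_half_sub_div {α : ℝ} (hα1 : α < 1) {m : ℕ → ℕ}
    (hmk : Tendsto (fun k : ℕ => (m k : ℝ) / k) atTop (𝓝 α)) :
    Tendsto (fun k : ℕ => ((2 * ((k - m k) / 2) : ℕ) : ℝ) / k) atTop (𝓝 (1 - α)) := by
  have h1 : Tendsto (fun k : ℕ => 1 - (m k : ℝ) / k - 1 / (k : ℝ)) atTop (𝓝 (1 - α)) := by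
    simpa using (hmk.const_sub 1).sub tendsto_one_div_atTop_nhds_zero_nat
  have hev : ∀ᶠ k : ℕ in atTop, 0 < k ∧ m k ≤ k := by
    filter_upwards [hmk.eventually_lt_const hα1, eventually_gt_atTop 0] with k hk hk0
    have hk' : (0 : ℝ) < k := by exact_mod_cast hk0
    rw [div_lt_one hk'] at hk
    exact ⟨hk0, by exact_mod_cast hk.le⟩
  refine tendsto_of_tendsto_of_tendsto_of_le_of_le' h1 (hmk.const_sub 1) ?_ ?_
  · filter_upwards [hev] with k ⟨hk0, hmk⟩
    have hk' : (0 : ℝ) < k := by exact_mod_cast hk0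
    have : (k : ℝ) ≤ (2 * ((k - m k) / 2) : ℕ) + m k + 1 := by
      exact_mod_cast (by omega : k ≤ 2 * ((k - m k) / 2) + m k + 1)
    rw [show (1 : ℝ) - m k / k - 1 / k = (k - m k - 1) / k by field_simp]
    gcongr
    linarith
  · filter_upwards [hev] with k ⟨hk0, hmk⟩
    have hk' : (0 : ℝ) < k := by exact_mod_cast hk0
    have : ((2 * ((k - m k) / 2) : ℕ) : ℝ) + m k ≤ k := by
      exact_mod_cast (by omega : 2 * ((k - m k) / 2) + m k ≤ k)
    rw [← div_self hk'.ne', ← sub_div]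
    gcongr
    linarith

/-- Large-deviations lower bound for the least singular value of Gaussian
random matrices: if `m_k/k → α ∈ (0,1)`, then for every `t > 0`,
`liminf_k (1/k) log(1/F_{k,m_k}(t)) ≥ ((1−α)/2) log((1−α)²/(e t²)) + (α/2) log α`. -/
theorem stmt11 (α : ℝ) (hα0 : 0 < α) (hα1 : α < 1) (m : ℕ → ℕ) (hm : ∀ k, 1 ≤ m k)
    (hmk : Filter.Tendsto (fun k : ℕ => (m k : ℝ) / k) Filter.atTop (nhds α))
    (t : ℝ) (ht : 0 < t) :
    ((1 - α) / 2) * Real.log ((1 - α) ^ 2 / (Real.exp 1 * t ^ 2)) + (α / 2) * Real.log α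
      ≤ Filter.liminf
          (fun k : ℕ => (1 / (k : ℝ)) * Real.log (1 / Fkm k (m k) t)) Filter.atTop := by
  set β := 1 - α with hβ
  have hβ0 : 0 < β := by linarith
  have ha := hmk
  have hb := tendsto_two_mul_half_sub_div hα1 hmk
  have hc : Tendsto (fun k : ℕ => 1 / (k : ℝ)) atTop (𝓝 0) := tendsto_one_div_atTop_nhds_zero_nat
  have hlim := (((hc.mul_const (log (√(2 * π))⁻¹)).sub
    (((hb.sqrt.add hc.sqrt).pow 2).div_const 2)).sub
    ((hb.div_const 2).mul
      ((((ha.add hb).const_mul (t ^ 2)).div (hb.pow 2) (pow_pos hβ0 2).ne').log (by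
        rw [← hβ, show α + β = 1 by ring]; positivity)))).sub
    ((ha.div_const 2).mul (((ha.add hb).div ha hα0.ne').log (by
        rw [← hβ, show α + β = 1 by ring]; positivity)))
  have hval : 0 * log (√(2 * π))⁻¹ - (√β + √0) ^ 2 / 2 -
      β / 2 * log (t ^ 2 * (α + β) / β ^ 2) - α / 2 * log ((α + β) / α) =
      β / 2 * log (β ^ 2 / (exp 1 * t ^ 2)) + α / 2 * log α := by
    rw [show α + β = 1 by ring, sqrt_zero, add_zero, sq_sqrt hβ0.le, one_div α, log_inv α, mul_one,
      log_div (by positivity) (by positivity), log_div (by positivity) (by positivity),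
      log_mul (by positivity) (by positivity), log_exp]
    ring
  rw [← hval, ← hlim.liminf_eq]
  refine liminf_le_liminf ?_ hlim.isBoundedUnder_ge ?_
  · filter_upwards [hb.eventually_const_lt hβ0] with k hk
    have hp : 0 < (k - m k) / 2 := by
      by_contra h
      simp [Nat.eq_zero_of_not_pos h] at hk
    exact sub_le_log_one_div_Fkm (hm k) hp (by omega) ht rfl rfl rfl
  · set q := (gaussianReal 0 1).real {x | |x| ≤ t}
    have hq : 0 < q := gaussianReal_abs_le_pos ht
    refine IsBoundedUnder.isCoboundedUnder_ge (isBoundedUnder_of_eventually_le (a := -log q) ?_)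
    filter_upwards [eventually_gt_atTop 0] with k hk
    have hk' : (0 : ℝ) < k := by exact_mod_cast hk
    have h := log_le_log (pow_pos hq k) (pow_le_Fkm hk (hm k) ht)
    rw [log_pow] at h
    rw [one_div (Fkm k (m k) t), log_inv, one_div, inv_mul_le_iff₀ hk']
    linarith
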